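/- Let V be a 3-dimensional real vector space, B ∈ Λ²(V*) and A ∈ V*. The spinorial actions of the B-field and A-field preserve the Chevalley pairing: for all φ, ψ ∈ Λ(V*), ⟨φ − B∧φ, ψ − B∧ψ⟩ = ⟨φ,ψ⟩ and ⟨φ − A∧τφ, ψ − A∧τψ⟩ = ⟨φ,ψ⟩, where τ is the grade involution. -/

import Mathlib

set_option synthInstance.maxHeartbeats 1000000
set_option maxHeartbeats 1000000

open Module ExteriorAlgebra

variable {V : Type*} [AddCommGroup V] [Module ℝ V]

/-- Projection onto the degree-`k` component of the exterior algebra `Λ(V*)`. -/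
noncomputable def gproj (V : Type*) [AddCommGroup V] [Module ℝ V] (k : ℕ) :
    ExteriorAlgebra ℝ (Module.Dual ℝ V) →ₗ[ℝ] ExteriorAlgebra ℝ (Module.Dual ℝ V) :=
  GradedAlgebra.proj (fun i : ℕ => ⋀[ℝ]^i (Module.Dual ℝ V)) k

/-- The Chevalley pairing on `Λ(V*)` for a `3`-dimensional space `V`:
`⟨φ,ψ⟩ = φ₀ψ₃ + ψ₀φ₃ − φ₁∧ψ₂ − ψ₁∧φ₂`. -/
noncomputable def chevPair (φ ψ : ExteriorAlgebra ℝ (Module.Dual ℝ V)) :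
    ExteriorAlgebra ℝ (Module.Dual ℝ V) :=
  gproj V 0 φ * gproj V 3 ψ + gproj V 0 ψ * gproj V 3 φ
    - gproj V 1 φ * gproj V 2 ψ - gproj V 1 ψ * gproj V 2 φ

section ExteriorPowers

variable {R M : Type*} [CommRing R] [AddCommGroup M] [Module R M]

theorem ExteriorAlgebra.involute_of_mem_exteriorPower {n : ℕ} {x : ExteriorAlgebra R M}
    (hx : x ∈ ⋀[R]^n M) : CliffordAlgebra.involute x = (-1 : ExteriorAlgebra R M) ^ n * x := by
  induction hx using Submodule.pow_induction_on_left' with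
  | algebraMap r => simp
  | add x y i hx hy ihx ihy => rw [map_add, ihx, ihy, mul_add]
  | mem_mul m hm i x hx ih =>
    obtain ⟨v, rfl⟩ := hm
    have hv : CliffordAlgebra.involute (ι R v) = -ι R v := CliffordAlgebra.involute_ι v
    rw [map_mul, ih, hv, ← mul_assoc, ← mul_assoc, pow_succ,
      ((Commute.neg_one_left (ι R v)).pow_left i).neg_right.eq.symm]
    simp

theorem ExteriorAlgebra.ι_mul_of_mem_exteriorPower (v : M) {n : ℕ} {x : ExteriorAlgebra R M}
    (hx : x ∈ ⋀[R]^n M) : ι R v * x = (-1 : ExteriorAlgebra R M) ^ n * (x * ι R v) := by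
  induction hx using Submodule.pow_induction_on_left' with
  | algebraMap r => simp [Algebra.commutes]
  | add x y i hx hy ihx ihy => rw [mul_add, ihx, ihy, add_mul, mul_add]
  | mem_mul m hm i x hx ih =>
    obtain ⟨w, rfl⟩ := hm
    have hvw : ι R v * ι R w = -(ι R w * ι R v) :=
      eq_neg_of_add_eq_zero_left (ι_add_mul_swap v w)
    rw [← mul_assoc, hvw, neg_mul, mul_assoc, ih, ← mul_assoc,
      ((Commute.neg_one_left (ι R w)).pow_left i).eq.symm, pow_succ]
    simp [mul_assoc]

end ExteriorPowers

theorem gproj_mem (k : ℕ) (φ : ExteriorAlgebra ℝ (Module.Dual ℝ V)) :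
    gproj V k φ ∈ ⋀[ℝ]^k (Module.Dual ℝ V) :=
  SetLike.coe_mem _

theorem gproj_of_mem {k : ℕ} {φ : ExteriorAlgebra ℝ (Module.Dual ℝ V)}
    (hφ : φ ∈ ⋀[ℝ]^k (Module.Dual ℝ V)) (j : ℕ) : gproj V j φ = if k = j then φ else 0 := by
  split_ifs with h
  · subst h
    exact DirectSum.decompose_of_mem_same (fun i : ℕ => ⋀[ℝ]^i (Module.Dual ℝ V)) hφ
  · exact DirectSum.decompose_of_mem_ne (fun i : ℕ => ⋀[ℝ]^i (Module.Dual ℝ V)) hφ h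

theorem gproj_mul_of_le {i k : ℕ} {b : ExteriorAlgebra ℝ (Module.Dual ℝ V)}
    (hb : b ∈ ⋀[ℝ]^i (Module.Dual ℝ V)) (hik : i ≤ k)
    (φ : ExteriorAlgebra ℝ (Module.Dual ℝ V)) :
    gproj V k (b * φ) = b * gproj V (k - i) φ :=
  DirectSum.coe_decompose_mul_of_left_mem_of_le
    (fun i : ℕ => ⋀[ℝ]^i (Module.Dual ℝ V)) hb hik

theorem gproj_mul_of_not_le {i k : ℕ} {b : ExteriorAlgebra ℝ (Module.Dual ℝ V)}
    (hb : b ∈ ⋀[ℝ]^i (Module.Dual ℝ V)) (hik : ¬ i ≤ k)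
    (φ : ExteriorAlgebra ℝ (Module.Dual ℝ V)) : gproj V k (b * φ) = 0 :=
  DirectSum.coe_decompose_mul_of_left_mem_of_not_le
    (fun i : ℕ => ⋀[ℝ]^i (Module.Dual ℝ V)) hb hik

theorem gproj_involute (k : ℕ) (φ : ExteriorAlgebra ℝ (Module.Dual ℝ V)) :
    gproj V k (CliffordAlgebra.involute φ) =
      (-1 : ExteriorAlgebra ℝ (Module.Dual ℝ V)) ^ k * gproj V k φ := by
  induction φ using DirectSum.Decomposition.inductionOn
    (fun i : ℕ => ⋀[ℝ]^i (Module.Dual ℝ V)) with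
  | zero => simp
  | add x y hx hy => rw [map_add, map_add, map_add, hx, hy, mul_add]
  | @homogeneous i x =>
    rw [involute_of_mem_exteriorPower x.2, gproj_of_mem x.2]
    have h : (-1 : ExteriorAlgebra ℝ (Module.Dual ℝ V)) ^ i * (x : ExteriorAlgebra ℝ _)
        ∈ ⋀[ℝ]^i (Module.Dual ℝ V) := by
      rcases neg_one_pow_eq_or (ExteriorAlgebra ℝ (Module.Dual ℝ V)) i with h | h <;> simp [h]
    rw [gproj_of_mem h]
    split_ifs with hik
    · subst hik
      rfl
    · simp

theorem exists_algebraMap_eq_gproj_zero (φ : ExteriorAlgebra ℝ (Module.Dual ℝ V)) :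
    ∃ r : ℝ, algebraMap ℝ _ r = gproj V 0 φ := by
  have h := gproj_mem 0 φ
  rwa [exteriorPower, pow_zero, Submodule.mem_one] at h

theorem exists_ι_eq_gproj_one (φ : ExteriorAlgebra ℝ (Module.Dual ℝ V)) :
    ∃ v : Module.Dual ℝ V, ι ℝ v = gproj V 1 φ := by
  have h := gproj_mem 1 φ
  rwa [exteriorPower, pow_one] at h

theorem chevPair_sub_mul_of_mem {B : ExteriorAlgebra ℝ (Module.Dual ℝ V)}
    (hB : B ∈ ⋀[ℝ]^2 (Module.Dual ℝ V)) (φ ψ : ExteriorAlgebra ℝ (Module.Dual ℝ V)) :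
    chevPair (φ - B * φ) (ψ - B * ψ) = chevPair φ ψ := by
  have h0 := gproj_mul_of_not_le hB (k := 0) (by norm_num)
  have h1 := gproj_mul_of_not_le hB (k := 1) (by norm_num)
  have h2 := gproj_mul_of_le hB (k := 2) (by norm_num)
  have h3 := gproj_mul_of_le hB (k := 3) (by norm_num)
  norm_num at h2 h3
  obtain ⟨r, hr⟩ := exists_algebraMap_eq_gproj_zero φ
  obtain ⟨s, hs⟩ := exists_algebraMap_eq_gproj_zero ψ
  obtain ⟨v, hv⟩ := exists_ι_eq_gproj_one φ
  obtain ⟨w, hw⟩ := exists_ι_eq_gproj_one ψ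
  have hvB := ι_mul_of_mem_exteriorPower v hB
  have hwB := ι_mul_of_mem_exteriorPower w hB
  norm_num at hvB hwB
  simp only [chevPair, map_sub, h0, h1, h2, h3, ← hr, ← hs, ← hv, ← hw,
    Algebra.algebraMap_eq_smul_one, mul_sub, mul_smul_comm, smul_mul_assoc,
    mul_one, one_mul, hvB, hwB, sub_zero]
  abel

theorem chevPair_sub_ι_mul_involute (A : Module.Dual ℝ V)
    (φ ψ : ExteriorAlgebra ℝ (Module.Dual ℝ V)) :
    chevPair (φ - ι ℝ A * CliffordAlgebra.involute φ)
      (ψ - ι ℝ A * CliffordAlgebra.involute ψ) = chevPair φ ψ := by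
  have hA : ι ℝ A ∈ ⋀[ℝ]^1 (Module.Dual ℝ V) := by
    rw [exteriorPower, pow_one]
    exact LinearMap.mem_range_self _ A
  have h0 := gproj_mul_of_not_le hA (k := 0) (by norm_num)
  have h1 := gproj_mul_of_le hA (k := 1) (by norm_num)
  have h2 := gproj_mul_of_le hA (k := 2) (by norm_num)
  have h3 := gproj_mul_of_le hA (k := 3) (by norm_num)
  norm_num at h1 h2 h3
  obtain ⟨r, hr⟩ := exists_algebraMap_eq_gproj_zero φ
  obtain ⟨s, hs⟩ := exists_algebraMap_eq_gproj_zero ψ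
  obtain ⟨v, hv⟩ := exists_ι_eq_gproj_one φ
  obtain ⟨w, hw⟩ := exists_ι_eq_gproj_one ψ
  have hAA (x : ExteriorAlgebra ℝ (Module.Dual ℝ V)) : ι ℝ A * (ι ℝ A * x) = 0 := by
    rw [← mul_assoc, ι_sq_zero, zero_mul]
  have hvw : ι ℝ v * (ι ℝ A * ι ℝ w) = -(ι ℝ w * (ι ℝ A * ι ℝ v)) := by
    have hvA : ι ℝ v * ι ℝ A = -(ι ℝ A * ι ℝ v) :=
      eq_neg_of_add_eq_zero_left (ι_add_mul_swap v A)
    have hwA : ι ℝ w * ι ℝ A = -(ι ℝ A * ι ℝ w) :=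
      eq_neg_of_add_eq_zero_left (ι_add_mul_swap w A)
    have hvw' : ι ℝ v * ι ℝ w = -(ι ℝ w * ι ℝ v) :=
      eq_neg_of_add_eq_zero_left (ι_add_mul_swap v w)
    rw [← mul_assoc, ← mul_assoc, hvA, hwA, neg_mul, neg_mul, mul_assoc, mul_assoc, hvw', mul_neg]
  simp only [chevPair, map_sub, h0, h1, h2, h3, gproj_involute, ← hr, ← hs, ← hv, ← hw,
    Algebra.algebraMap_eq_smul_one, pow_zero, pow_one, neg_one_sq, neg_mul, mul_neg, mul_sub,
    sub_mul, mul_add, sub_neg_eq_add, mul_smul_comm, smul_mul_assoc,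
    mul_one, one_mul, hAA, smul_zero, hvw, sub_zero]
  abel

/-- On a `3`-dimensional space, the spinorial actions of a `B`-field
(`φ ↦ φ − B∧φ`, `B ∈ Λ²(V*)`) and of an `A`-field (`φ ↦ φ − A∧τφ`, `A ∈ V*`)
preserve the Chevalley pairing. -/
theorem chevPair_invariant [FiniteDimensional ℝ V] (h3 : Module.finrank ℝ V = 3)
    (B : ExteriorAlgebra ℝ (Module.Dual ℝ V)) (hB : B ∈ ⋀[ℝ]^2 (Module.Dual ℝ V))
    (A : Module.Dual ℝ V)
    (φ ψ : ExteriorAlgebra ℝ (Module.Dual ℝ V)) :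
    chevPair (φ - B * φ) (ψ - B * ψ) = chevPair φ ψ ∧
    chevPair (φ - ExteriorAlgebra.ι ℝ A * CliffordAlgebra.involute φ)
        (ψ - ExteriorAlgebra.ι ℝ A * CliffordAlgebra.involute ψ) = chevPair φ ψ := by
  exact ⟨chevPair_sub_mul_of_mem hB φ ψ, chevPair_sub_ι_mul_involute A φ ψ⟩
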